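/- Let N ≥ 1, q = 2^N, and let π be a permutation of {0,…,q−1}. Then the aperiodic subsystem (I_np, F_π) of the rotated odometer is minimal: for every x ∈ I_np, the closure in ℝ of the forward orbit {F_π^k(x) : k ≥ 0} contains I_np. -/

import Mathlib

open MeasureTheory Set Function
open scoped ENNReal

noncomputable section

/-- `A` is the von Neumann–Kakutani map on `[0,1)`:
`A x = x - (1 - 3·2⁻ⁿ)` for `x ∈ [1 - 2^(1-n), 1 - 2^(-n))`, `n ≥ 1`. -/
def IsVNK (A : ℝ → ℝ) : Prop :=
  ∀ n : ℕ, 1 ≤ n →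
    ∀ x ∈ Set.Ico (1 - (2:ℝ) ^ (1 - (n:ℤ))) (1 - (2:ℝ) ^ (-(n:ℤ))),
      A x = x - (1 - 3 * (2:ℝ) ^ (-(n:ℤ)))

/-- `R` is the interval exchange of the `q` intervals of length `1/q` determined by the
permutation `π`: `R x = x + (π p - p)/q` for `x ∈ [p/q, (p+1)/q)`. -/
def IsIET (q : ℕ) (π : Equiv.Perm (Fin q)) (R : ℝ → ℝ) : Prop :=
  ∀ p : Fin q,
    ∀ x ∈ Set.Ico (((p : ℕ) : ℝ) / (q : ℝ)) ((((p : ℕ) : ℝ) + 1) / (q : ℝ)),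
      R x = x + (((π p : ℕ) : ℝ) - ((p : ℕ) : ℝ)) / (q : ℝ)

/-- The set of periodic points of `F` in `[0,1)`. -/
def Iper (F : ℝ → ℝ) : Set ℝ :=
  {x ∈ Set.Ico (0:ℝ) 1 | ∃ k, 1 ≤ k ∧ F^[k] x = x}

/-- The set of non-periodic points of `F` in `[0,1)`. -/
def Inp (F : ℝ → ℝ) : Set ℝ := Set.Ico (0:ℝ) 1 \ Iper F

/-- The point of `[0,1)` at relative position `u` in the `p`-th of `q` equal intervals. -/
def intervalPoint (q : ℕ) (p : Fin q) (u : ℝ) : ℝ := (((p : ℕ) : ℝ) + u) / (q : ℝ)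

lemma exists_eq_intervalPoint {q : ℕ} [NeZero q] {x : ℝ} (hx : x ∈ Ico (0:ℝ) 1) :
    ∃ p : Fin q, ∃ u ∈ Ico (0:ℝ) 1, x = intervalPoint q p u := by
  have hq : (0:ℝ) < q := by exact_mod_cast NeZero.pos q
  have h0 : 0 ≤ x * q := mul_nonneg hx.1 hq.le
  have hlt : ⌊x * q⌋₊ < q := by
    rw [Nat.floor_lt h0]
    nlinarith [hx.2]
  refine ⟨⟨⌊x * q⌋₊, hlt⟩, x * q - ⌊x * q⌋₊, ⟨?_, ?_⟩, ?_⟩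
  · linarith [Nat.floor_le h0]
  · linarith [Nat.lt_floor_add_one (x * q)]
  · unfold intervalPoint
    field_simp
    ring

lemma intervalPoint_mem {q : ℕ} (p : Fin q) {u : ℝ} (hu : u ∈ Ico (0:ℝ) 1) :
    intervalPoint q p u ∈ Ico (0:ℝ) 1 := by
  have hp : ((p : ℕ) : ℝ) + 1 ≤ q := by exact_mod_cast p.2
  have h0 : (0:ℝ) ≤ (p : ℕ) := Nat.cast_nonneg _
  have hq : (0:ℝ) < q := by linarith
  unfold intervalPoint
  refine ⟨div_nonneg (by linarith [hu.1]) hq.le, ?_⟩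
  rw [div_lt_one hq]
  linarith [hu.2]

lemma abs_intervalPoint_sub_le {q : ℕ} (p : Fin q) (u v : ℝ) :
    |intervalPoint q p u - intervalPoint q p v| ≤ |u - v| := by
  have hq : (1:ℝ) ≤ q := by exact_mod_cast (Nat.zero_lt_of_lt p.2)
  have h : intervalPoint q p u - intervalPoint q p v = (u - v) / q := by
    unfold intervalPoint
    ring
  rw [h, abs_div, abs_of_pos (by linarith : (0:ℝ) < q)]
  exact div_le_self (abs_nonneg _) hq

lemma IsIET.apply_intervalPoint {q : ℕ} {π : Equiv.Perm (Fin q)} {R : ℝ → ℝ} (hR : IsIET q π R)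
    (p : Fin q) {u : ℝ} (hu : u ∈ Ico (0:ℝ) 1) :
    R (intervalPoint q p u) = intervalPoint q (π p) u := by
  have hq : (0:ℝ) < q := by exact_mod_cast (Nat.zero_lt_of_lt p.2)
  unfold intervalPoint
  rw [hR p _ ⟨by gcongr; linarith [hu.1], by gcongr; exact hu.2⟩]
  ring

namespace IsVNK

variable {A : ℝ → ℝ}

lemma apply_of_mem (hA : IsVNK A) (n : ℕ) {x : ℝ} (h₁ : 1 - (1 / 2 : ℝ) ^ n ≤ x)
    (h₂ : x < 1 - (1 / 2 : ℝ) ^ (n + 1)) : A x = x - 1 + 3 * (1 / 2 : ℝ) ^ (n + 1) := by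
  have e₁ : (2:ℝ) ^ (1 - ((n + 1 : ℕ) : ℤ)) = (1 / 2 : ℝ) ^ n := by
    rw [show 1 - ((n + 1 : ℕ) : ℤ) = -(n : ℤ) by push_cast; ring, zpow_neg, zpow_natCast]
    simp
  have e₂ : (2:ℝ) ^ (-((n + 1 : ℕ) : ℤ)) = (1 / 2 : ℝ) ^ (n + 1) := by
    rw [zpow_neg, zpow_natCast]
    simp
  have h := hA (n + 1) (by omega) x (by rw [e₁, e₂]; exact ⟨h₁, h₂⟩)
  rw [h, e₂]
  ring

lemma exists_level {x : ℝ} (hx : x ∈ Ico (0:ℝ) 1) :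
    ∃ n : ℕ, 1 - (1 / 2 : ℝ) ^ n ≤ x ∧ x < 1 - (1 / 2 : ℝ) ^ (n + 1) := by
  obtain ⟨n, h₁, h₂⟩ := exists_nat_pow_near_of_lt_one (x := 1 - x) (y := (1 / 2 : ℝ))
    (by linarith [hx.2]) (by linarith [hx.1]) (by norm_num) (by norm_num)
  exact ⟨n, by linarith, by linarith⟩

lemma apply_mem (hA : IsVNK A) {x : ℝ} (hx : x ∈ Ico (0:ℝ) 1) : A x ∈ Ico (0:ℝ) 1 := by
  obtain ⟨n, h₁, h₂⟩ := exists_level hx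
  have hpos : (0:ℝ) < (1 / 2 : ℝ) ^ n := by positivity
  have hle : (1 / 2 : ℝ) ^ n ≤ 1 := pow_le_one₀ (by norm_num) (by norm_num)
  rw [hA.apply_of_mem n h₁ h₂]
  rw [pow_succ] at h₂ ⊢
  constructor <;> linarith

lemma apply_left (hA : IsVNK A) {u : ℝ} (hu : u ∈ Ico (0:ℝ) 1) : A (u / 2) = (1 + u) / 2 := by
  rw [hA.apply_of_mem 0 (by norm_num; linarith [hu.1]) (by norm_num; linarith [hu.2])]
  ring

lemma apply_right (hA : IsVNK A) {u : ℝ} (hu : u ∈ Ico (0:ℝ) 1) :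
    A ((1 + u) / 2) = A u / 2 := by
  obtain ⟨n, h₁, h₂⟩ := exists_level hu
  rw [hA.apply_of_mem n h₁ h₂, hA.apply_of_mem (n + 1)
    (by rw [pow_succ]; linarith) (by rw [pow_succ _ (n + 1)]; linarith)]
  ring

lemma iterate_mem (hA : IsVNK A) {u : ℝ} (hu : u ∈ Ico (0:ℝ) 1) (k : ℕ) :
    A^[k] u ∈ Ico (0:ℝ) 1 :=
  MapsTo.iterate (fun _ h => hA.apply_mem h) k hu

lemma iterate_two_mul (hA : IsVNK A) {u : ℝ} (hu : u ∈ Ico (0:ℝ) 1) (k : ℕ) :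
    A^[2 * k] (u / 2) = A^[k] u / 2 := by
  induction k with
  | zero => rfl
  | succ k ih =>
    have hk := hA.iterate_mem hu k
    rw [show 2 * (k + 1) = 2 * k + 1 + 1 by ring, iterate_succ_apply', iterate_succ_apply', ih,
      hA.apply_left hk, hA.apply_right hk, iterate_succ_apply']

lemma exists_iterate_abs_sub_le (hA : IsVNK A) (m : ℕ) {y t : ℝ} (hy : y ∈ Ico (0:ℝ) 1)
    (ht : t ∈ Ico (0:ℝ) 1) : ∃ k : ℕ, |A^[k] y - t| ≤ (1 / 2 : ℝ) ^ m := by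
  induction m generalizing y t with
  | zero =>
    refine ⟨0, ?_⟩
    rw [pow_zero, iterate_zero_apply, abs_le]
    constructor <;> linarith [hy.1, hy.2, ht.1, ht.2]
  | succ m ih =>
    have left : ∀ u ∈ Ico (0:ℝ) 1, ∃ k : ℕ, |A^[k] (u / 2) - t| ≤ (1 / 2 : ℝ) ^ (m + 1) := by
      intro u hu
      rcases lt_or_ge t (1 / 2) with h | h
      · obtain ⟨k, hk⟩ := ih hu (t := 2 * t) ⟨by linarith [ht.1], by linarith⟩
        refine ⟨2 * k, ?_⟩
        rw [hA.iterate_two_mul hu, pow_succ]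
        rw [abs_le] at hk ⊢
        constructor <;> linarith [hk.1, hk.2]
      · obtain ⟨k, hk⟩ := ih hu (t := 2 * t - 1) ⟨by linarith, by linarith [ht.2]⟩
        refine ⟨2 * k + 1, ?_⟩
        rw [iterate_succ_apply', hA.iterate_two_mul hu, hA.apply_left (hA.iterate_mem hu k),
          pow_succ]
        rw [abs_le] at hk ⊢
        constructor <;> linarith [hk.1, hk.2]
    rcases lt_or_ge y (1 / 2) with h | h
    · simpa using left (2 * y) ⟨by linarith [hy.1], by linarith⟩
    · have hu : 2 * y - 1 ∈ Ico (0:ℝ) 1 := ⟨by linarith, by linarith [hy.2]⟩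
      obtain ⟨k, hk⟩ := left _ (hA.apply_mem hu)
      refine ⟨k + 1, ?_⟩
      rwa [iterate_succ_apply, show y = (1 + (2 * y - 1)) / 2 by ring, hA.apply_right hu]

lemma exists_nat_permutation (hA : IsVNK A) (N : ℕ) : ∃ τ : ℕ → ℕ,
    (∀ p < 2 ^ N, τ p < 2 ^ N) ∧ (∀ p < 2 ^ N, ∀ r < 2 ^ N, τ p = τ r → p = r) ∧
    ∀ p : ℕ, p < 2 ^ N → ∀ u ∈ Ico (0:ℝ) 1,
      A (((p : ℝ) + u) / 2 ^ N) = ((τ p : ℝ) + if τ p = 0 then A u else u) / 2 ^ N := by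
  induction N with
  | zero =>
    refine ⟨id, fun p hp => hp, fun p _ r _ h => h, fun p hp u _ => ?_⟩
    obtain rfl : p = 0 := by simpa using hp
    simp
  | succ N ih =>
    obtain ⟨τ, hlt, hinj, hτ⟩ := ih
    have h2 : 2 ^ (N + 1) = 2 ^ N + 2 ^ N := by ring
    have hscale : ∀ p : ℕ, p < 2 ^ N → ∀ u ∈ Ico (0:ℝ) 1, ((p : ℝ) + u) / 2 ^ N ∈ Ico (0:ℝ) 1 := by
      intro p hp u hu
      simpa [intervalPoint] using intervalPoint_mem (⟨p, hp⟩ : Fin (2 ^ N)) hu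
    refine ⟨fun p => if p < 2 ^ N then 2 ^ N + p else τ (p - 2 ^ N), ?_, ?_, ?_⟩
    · intro p hp
      have := hlt (p - 2 ^ N)
      dsimp only
      split_ifs <;> omega
    · intro p hp r hr h
      have h₁ := hlt (p - 2 ^ N)
      have h₂ := hlt (r - 2 ^ N)
      dsimp only at h
      split_ifs at h
      · omega
      · omega
      · omega
      · have := hinj (p - 2 ^ N) (by omega) (r - 2 ^ N) (by omega) h
        omega
    · intro p hp u hu
      by_cases hpN : p < 2 ^ N
      · have hne : 2 ^ N + p ≠ 0 := by omega
        have h := hA.apply_left (hscale p hpN u hu)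
        simp only [hpN, if_true, hne, if_false]
        rw [pow_succ, ← div_div, h]
        push_cast
        field_simp
        ring
      · obtain ⟨r, rfl⟩ := Nat.exists_eq_add_of_le (not_lt.mp hpN)
        have hr : r < 2 ^ N := by omega
        simp only [hpN, if_false, Nat.add_sub_cancel_left]
        have e : (((2 ^ N + r : ℕ) : ℝ) + u) / 2 ^ (N + 1) = (1 + ((r : ℝ) + u) / 2 ^ N) / 2 := by
          push_cast
          rw [pow_succ]
          field_simp
          ring
        rw [e, hA.apply_right (hscale r hr u hu), hτ r hr u hu, pow_succ, div_div]

lemma exists_permutation (hA : IsVNK A) (N : ℕ) : ∃ τ : Equiv.Perm (Fin (2 ^ N)),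
    ∀ p, ∀ u ∈ Ico (0:ℝ) 1, A (intervalPoint (2 ^ N) p u) =
      intervalPoint (2 ^ N) (τ p) (if τ p = 0 then A u else u) := by
  obtain ⟨τ, hlt, hinj, hτ⟩ := hA.exists_nat_permutation N
  have hbij : Bijective fun p : Fin (2 ^ N) => (⟨τ p, hlt p p.2⟩ : Fin (2 ^ N)) :=
    Finite.injective_iff_bijective.mp fun p r h =>
      Fin.ext (hinj p p.2 r r.2 (Fin.ext_iff.mp h))
  refine ⟨Equiv.ofBijective _ hbij, fun p u hu => ?_⟩
  simpa [intervalPoint, Fin.ext_iff] using hτ p p.2 u hu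

end IsVNK

/-- `F` permutes the `q` equal intervals of `[0,1)` according to `σ`, acting as a translation
except on entering the interval `0`, where `A` is applied in the relative coordinate. -/
def IsTowerMap (q : ℕ) [NeZero q] (σ : Equiv.Perm (Fin q)) (A F : ℝ → ℝ) : Prop :=
  ∀ p, ∀ u ∈ Ico (0:ℝ) 1, F (intervalPoint q p u) =
    intervalPoint q (σ p) (if σ p = 0 then A u else u)

namespace IsTowerMap

variable {q : ℕ} [NeZero q] {σ : Equiv.Perm (Fin q)} {A F : ℝ → ℝ}

lemma iterate_of_ne_zero (hF : IsTowerMap q σ A F) {p : Fin q} {u : ℝ} (hu : u ∈ Ico (0:ℝ) 1)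
    (k : ℕ) (h : ∀ i < k, (σ ^ (i + 1)) p ≠ 0) :
    F^[k] (intervalPoint q p u) = intervalPoint q ((σ ^ k) p) u := by
  induction k with
  | zero => rfl
  | succ k ih =>
    have hk : σ ((σ ^ k) p) ≠ 0 := by
      simpa [pow_succ', Equiv.Perm.mul_apply] using h k k.lt_succ_self
    rw [iterate_succ_apply', ih fun i hi => h i (hi.trans k.lt_succ_self), hF _ u hu, if_neg hk,
      pow_succ', Equiv.Perm.mul_apply]

lemma exists_iterate_eq (hA : MapsTo A (Ico 0 1) (Ico 0 1)) (hF : IsTowerMap q σ A F)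
    (p : Fin q) {u : ℝ} (hu : u ∈ Ico (0:ℝ) 1) (k : ℕ) :
    ∃ v ∈ Ico (0:ℝ) 1, F^[k] (intervalPoint q p u) = intervalPoint q ((σ ^ k) p) v := by
  induction k with
  | zero => exact ⟨u, hu, rfl⟩
  | succ k ih =>
    obtain ⟨v, hv, h⟩ := ih
    refine ⟨_, ?_, by rw [iterate_succ_apply', h, hF _ v hv, pow_succ', Equiv.Perm.mul_apply]⟩
    split_ifs
    exacts [hA hv, hv]

/-- The tower over the interval `0` reaches every interval of the cycle of `0` before
returning. -/
lemma exists_iterate_zero_eq (hF : IsTowerMap q σ A F) {r : Fin q} (hr : σ.SameCycle 0 r) :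
    ∃ s : ℕ, ∀ u ∈ Ico (0:ℝ) 1, F^[s] (intervalPoint q 0 u) = intervalPoint q r u := by
  have hex : ∃ s : ℕ, (σ ^ s) 0 = r := hr.exists_nat_pow_eq
  classical
  refine ⟨Nat.find hex, fun u hu => ?_⟩
  rw [hF.iterate_of_ne_zero hu, Nat.find_spec hex]
  intro i hi h0
  refine Nat.find_min hex (m := Nat.find hex - (i + 1)) (by omega) ?_
  have h := Nat.find_spec hex
  rw [show Nat.find hex = (Nat.find hex - (i + 1)) + (i + 1) by omega, pow_add,
    Equiv.Perm.mul_apply, h0] at h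
  exact h

lemma exists_iterate_zero_eq_iterate (hA : MapsTo A (Ico 0 1) (Ico 0 1))
    (hF : IsTowerMap q σ A F) {u : ℝ} (hu : u ∈ Ico (0:ℝ) 1) (n : ℕ) :
    ∃ k : ℕ, F^[k] (intervalPoint q 0 u) = intervalPoint q 0 (A^[n] u) := by
  obtain ⟨s, hs⟩ := hF.exists_iterate_zero_eq (r := σ.symm 0)
    (Equiv.Perm.SameCycle.refl σ 0).symm_apply_right
  induction n with
  | zero => exact ⟨0, rfl⟩
  | succ n ih =>
    obtain ⟨k, hk⟩ := ih
    have hn : A^[n] u ∈ Ico (0:ℝ) 1 := hA.iterate n hu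
    refine ⟨s + 1 + k, ?_⟩
    rw [iterate_add_apply, hk, iterate_succ_apply', hs _ hn, hF _ _ hn, iterate_succ_apply']
    simp

lemma sameCycle_of_mem_Inp (hF : IsTowerMap q σ A F) {p : Fin q} {u : ℝ}
    (hu : u ∈ Ico (0:ℝ) 1) (h : intervalPoint q p u ∈ Inp F) : σ.SameCycle 0 p := by
  by_contra hp
  refine h.2 ⟨h.1, orderOf σ, orderOf_pos σ, ?_⟩
  rw [hF.iterate_of_ne_zero hu _ fun i _ h0 => hp ?_, pow_orderOf_eq_one, Equiv.Perm.one_apply]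
  exact Equiv.Perm.SameCycle.symm ⟨((i + 1 : ℕ) : ℤ), by rw [zpow_natCast, h0]⟩

end IsTowerMap

/-- for `q = 2^N`, the aperiodic subsystem `(I_np, F_π)` of the rotated
odometer `F_π = ā ∘ R_π` is minimal: for every `x ∈ I_np` the closure of the forward
orbit of `x` contains `I_np`. -/
theorem stmt4 (N : ℕ) (hN : 1 ≤ N) (π : Equiv.Perm (Fin (2^N)))
    (A R F : ℝ → ℝ) (hA : IsVNK A) (hR : IsIET (2^N) π R) (hF : ∀ x, F x = A (R x)) :
    ∀ x ∈ Inp F, Inp F ⊆ closure (Set.range fun k : ℕ => F^[k] x) := by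
  intro x hx z hz
  obtain ⟨τ, hτ⟩ := hA.exists_permutation N
  have hmaps : MapsTo A (Ico 0 1) (Ico 0 1) := fun _ h => hA.apply_mem h
  have hT : IsTowerMap (2 ^ N) (τ * π) A F := fun p u hu => by
    rw [hF, hR.apply_intervalPoint p hu, hτ _ u hu, Equiv.Perm.mul_apply]
  obtain ⟨p, u, hu, rfl⟩ := exists_eq_intervalPoint (q := 2 ^ N) hx.1
  obtain ⟨r, t, ht, rfl⟩ := exists_eq_intervalPoint (q := 2 ^ N) hz.1
  obtain ⟨i, hi⟩ := (hT.sameCycle_of_mem_Inp hu hx).symm.exists_nat_pow_eq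
  obtain ⟨v, hv, hiv⟩ := hT.exists_iterate_eq hmaps p hu i
  obtain ⟨s, hs⟩ := hT.exists_iterate_zero_eq (hT.sameCycle_of_mem_Inp ht hz)
  rw [Metric.mem_closure_range_iff]
  intro ε hε
  obtain ⟨m, hm⟩ := exists_pow_lt_of_lt_one hε (by norm_num : (1 / 2 : ℝ) < 1)
  obtain ⟨n, hn⟩ := hA.exists_iterate_abs_sub_le m hv ht
  obtain ⟨k, hk⟩ := hT.exists_iterate_zero_eq_iterate hmaps hv n
  refine ⟨s + (k + i), ?_⟩
  rw [iterate_add_apply, iterate_add_apply, hiv, hi, hk, hs _ (hA.iterate_mem hv n), dist_comm,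
    Real.dist_eq]
  exact ((abs_intervalPoint_sub_le r _ _).trans hn).trans_lt hm
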